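/- arXiv:math/9901133 — 4 statements merged into one kernel-verified Lean document; each statement's English description precedes it below -/
import Mathlib

section
/- Let i, j, k be integers with i ≠ 0 or k ≠ 0. In the group G_STK = ⟨a, b, f ∣ b a b⁻¹ = a⁻¹, b f b⁻¹ = f⁻¹, a f = f a⟩, the centralizer of the element aⁱ b^{2j} fᵏ is the subgroup generated by {a, b², f}, and this subgroup is isomorphic to ℤ³ (the free abelian group of rank 3). -/
/-- The relators of the presentation
`⟨a, b, f ∣ b a b⁻¹ = a⁻¹, b f b⁻¹ = f⁻¹, a f = f a⟩`, with `a, b, f` the generators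
`0, 1, 2`. -/
def stkRels : Set (FreeGroup (Fin 3)) :=
  {FreeGroup.of 1 * FreeGroup.of 0 * (FreeGroup.of 1)⁻¹ * FreeGroup.of 0,
   FreeGroup.of 1 * FreeGroup.of 2 * (FreeGroup.of 1)⁻¹ * FreeGroup.of 2,
   FreeGroup.of 0 * FreeGroup.of 2 * (FreeGroup.of 0)⁻¹ * (FreeGroup.of 2)⁻¹}

/-- The group `G_STK = ⟨a, b, f ∣ b a b⁻¹ = a⁻¹, b f b⁻¹ = f⁻¹, a f = f a⟩`. -/
abbrev GSTK : Type := PresentedGroup stkRels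

namespace GSTK

/-- The generator `a` of `G_STK`. -/
def a : GSTK := PresentedGroup.of 0

/-- The generator `b` of `G_STK`. -/
def b : GSTK := PresentedGroup.of 1

/-- The generator `f` of `G_STK`. -/
def f : GSTK := PresentedGroup.of 2

end GSTK

namespace GSTK

theorem b_mul_a_mul_inv : b * a * b⁻¹ = a⁻¹ :=
  eq_inv_of_mul_eq_one_left
    (PresentedGroup.one_of_mem (rels := stkRels) (Set.mem_insert _ _))

theorem b_mul_f_mul_inv : b * f * b⁻¹ = f⁻¹ :=
  eq_inv_of_mul_eq_one_left
    (PresentedGroup.one_of_mem (rels := stkRels) (Set.mem_insert_of_mem _ (Set.mem_insert _ _)))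

theorem commute_a_f : Commute a f :=
  mul_inv_eq_iff_eq_mul.mp <| mul_inv_eq_one.mp <|
    PresentedGroup.one_of_mem (rels := stkRels)
      (Set.mem_insert_of_mem _ (Set.mem_insert_of_mem _ rfl))

theorem b_mul_a_zpow (n : ℤ) : b * a ^ n = a ^ (-n) * b := by
  rw [← mul_inv_eq_iff_eq_mul, ← conj_zpow, b_mul_a_mul_inv, inv_zpow']

theorem b_mul_f_zpow (n : ℤ) : b * f ^ n = f ^ (-n) * b := by
  rw [← mul_inv_eq_iff_eq_mul, ← conj_zpow, b_mul_f_mul_inv, inv_zpow']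

theorem commute_b_sq_a : Commute (b ^ 2) a := by
  have h₁ := b_mul_a_zpow 1
  have h₂ := b_mul_a_zpow (-1)
  simp only [neg_neg, zpow_one] at h₁ h₂
  rw [Commute, SemiconjBy, sq, mul_assoc, h₁, ← mul_assoc, h₂, mul_assoc]

theorem commute_b_sq_f : Commute (b ^ 2) f := by
  have h₁ := b_mul_f_zpow 1
  have h₂ := b_mul_f_zpow (-1)
  simp only [neg_neg, zpow_one] at h₁ h₂
  rw [Commute, SemiconjBy, sq, mul_assoc, h₁, ← mul_assoc, h₂, mul_assoc]

/-- The homomorphism `(p, q, r) ↦ a ^ p * (b ^ 2) ^ q * f ^ r` from `ℤ³`. -/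
def latticeHom : Multiplicative (ℤ × ℤ × ℤ) →* GSTK where
  toFun v := a ^ v.toAdd.1 * (b ^ 2) ^ v.toAdd.2.1 * f ^ v.toAdd.2.2
  map_one' := by simp
  map_mul' v w := by
    simp only [toAdd_mul, Prod.fst_add, Prod.snd_add, zpow_add]
    rw [((commute_a_f.zpow_zpow w.toAdd.1 v.toAdd.2.2).symm.mul_right
      (commute_b_sq_f.zpow_zpow w.toAdd.2.1 v.toAdd.2.2).symm).mul_mul_mul_comm,
      (commute_b_sq_a.zpow_zpow v.toAdd.2.1 w.toAdd.1).mul_mul_mul_comm]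

theorem latticeHom_ofAdd (p q r : ℤ) :
    latticeHom (.ofAdd (p, q, r)) = a ^ p * (b ^ 2) ^ q * f ^ r := rfl

theorem range_latticeHom : latticeHom.range = Subgroup.closure {a, b ^ 2, f} := by
  apply le_antisymm
  · rintro _ ⟨v, rfl⟩
    refine mul_mem (mul_mem (zpow_mem ?_ _) (zpow_mem ?_ _)) (zpow_mem ?_ _) <;>
      exact Subgroup.subset_closure (by simp)
  · rw [Subgroup.closure_le]
    rintro _ (rfl | rfl | rfl)
    · exact ⟨.ofAdd (1, 0, 0), by simp [latticeHom_ofAdd]⟩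
    · exact ⟨.ofAdd (0, 1, 0), by simp [latticeHom_ofAdd]⟩
    · exact ⟨.ofAdd (0, 0, 1), by simp [latticeHom_ofAdd]⟩

theorem b_mul_latticeHom (p q r : ℤ) :
    b * latticeHom (.ofAdd (p, q, r)) = latticeHom (.ofAdd (-p, q, -r)) * b := by
  simp only [latticeHom_ofAdd]
  rw [← mul_assoc, ← mul_assoc, b_mul_a_zpow, mul_assoc (a ^ (-p)),
    ((Commute.refl b).pow_right 2).zpow_right q, mul_assoc, mul_assoc, mul_assoc,
    b_mul_f_zpow, ← mul_assoc]

theorem exists_latticeHom (g : GSTK) : ∃ v, g = latticeHom v ∨ g = latticeHom v * b := by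
  have lattice_mul (w) {g : GSTK} (hg : ∃ v, g = latticeHom v ∨ g = latticeHom v * b) :
      ∃ v, latticeHom w * g = latticeHom v ∨ latticeHom w * g = latticeHom v * b := by
    obtain ⟨v, rfl | rfl⟩ := hg
    · exact ⟨w * v, .inl (map_mul ..).symm⟩
    · exact ⟨w * v, .inr (by rw [map_mul, mul_assoc])⟩
  have b_mul {g : GSTK} (hg : ∃ v, g = latticeHom v ∨ g = latticeHom v * b) :
      ∃ v, b * g = latticeHom v ∨ b * g = latticeHom v * b := by
    obtain ⟨⟨p, q, r⟩, rfl | rfl⟩ := hg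
    · exact ⟨_, .inr (b_mul_latticeHom p q r)⟩
    · refine ⟨.ofAdd (-p, q, -r) * .ofAdd (0, 1, 0), .inl ?_⟩
      rw [← mul_assoc]
      erw [b_mul_latticeHom]
      simp [latticeHom_ofAdd, mul_assoc, sq]
  have ha : a = latticeHom (.ofAdd (1, 0, 0)) := by simp [latticeHom_ofAdd]
  have hf : f = latticeHom (.ofAdd (0, 0, 1)) := by simp [latticeHom_ofAdd]
  have hb : b⁻¹ = latticeHom (.ofAdd (0, -1, 0)) * b := by simp [latticeHom_ofAdd, sq]
  have hg : g ∈ Subgroup.closure (Set.range (PresentedGroup.of (rels := stkRels))) := by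
    simp [PresentedGroup.closure_range_of]
  induction hg using Subgroup.closure_induction_left with
  | one => exact ⟨1, .inl (map_one _).symm⟩
  | mul_left x hx y _ ih =>
    obtain ⟨i, rfl⟩ := hx
    fin_cases i
    · change ∃ v, a * y = _ ∨ a * y = _
      exact ha ▸ lattice_mul _ ih
    · exact b_mul ih
    · change ∃ v, f * y = _ ∨ f * y = _
      exact hf ▸ lattice_mul _ ih
  | inv_mul_cancel x hx y _ ih =>
    obtain ⟨i, rfl⟩ := hx
    fin_cases i
    · change ∃ v, a⁻¹ * y = _ ∨ a⁻¹ * y = _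
      rw [ha, ← map_inv]
      exact lattice_mul _ ih
    · change ∃ v, b⁻¹ * y = _ ∨ b⁻¹ * y = _
      rw [hb, mul_assoc]
      exact lattice_mul _ (b_mul ih)
    · change ∃ v, f⁻¹ * y = _ ∨ f⁻¹ * y = _
      rw [hf, ← map_inv]
      exact lattice_mul _ ih

/-- The glide reflection `(x, y, z) ↦ (-x, y + 1, -z)` of `ℤ³`. -/
def glide : Equiv.Perm (ℤ × ℤ × ℤ) where
  toFun v := (-v.1, v.2.1 + 1, -v.2.2)
  invFun v := (-v.1, v.2.1 - 1, -v.2.2)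
  left_inv v := by simp
  right_inv v := by simp

theorem glide_sq : glide ^ 2 = Equiv.addLeft ((0, 2, 0) : ℤ × ℤ × ℤ) := by
  ext v : 1
  simp only [sq, Equiv.Perm.mul_apply, Equiv.coe_addLeft, glide, Equiv.coe_fn_mk]
  ext <;> simp
  ring

/-- The action of `G_STK` on `ℤ³` in which `a` and `f` translate the first and last
coordinates and `b` acts by the glide reflection. -/
def toPerm : GSTK →* Equiv.Perm (ℤ × ℤ × ℤ) :=
  PresentedGroup.toGroup
    (f := ![Equiv.addLeft ((1, 0, 0) : ℤ × ℤ × ℤ), glide, Equiv.addLeft (0, 0, 1)]) <| by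
    rintro _ (rfl | rfl | rfl)
    all_goals
      simp only [map_mul, map_inv, FreeGroup.lift_apply_of]
      ext v <;> simp [glide]

theorem toPerm_latticeHom (p q r : ℤ) :
    toPerm (latticeHom (.ofAdd (p, q, r))) 0 = (p, 2 * q, r) := by
  have ha : toPerm a = Equiv.addLeft ((1, 0, 0) : ℤ × ℤ × ℤ) := PresentedGroup.toGroup.of _
  have hb : toPerm b = glide := PresentedGroup.toGroup.of _
  have hf : toPerm f = Equiv.addLeft ((0, 0, 1) : ℤ × ℤ × ℤ) := PresentedGroup.toGroup.of _
  simp [latticeHom_ofAdd, ha, hb, hf, glide_sq, mul_comm]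

theorem latticeHom_injective : Function.Injective latticeHom := by
  rintro ⟨p, q, r⟩ ⟨p', q', r'⟩ h
  have h' := congrArg (fun g ↦ toPerm g 0) h
  erw [toPerm_latticeHom, toPerm_latticeHom] at h'
  simp only [Prod.mk.injEq, mul_eq_mul_left_iff, OfNat.ofNat_ne_zero, or_false] at h'
  obtain ⟨rfl, rfl, rfl⟩ := h'
  rfl

theorem not_commute_b_latticeHom {p q r : ℤ} (h : p ≠ 0 ∨ r ≠ 0) :
    ¬ Commute b (latticeHom (.ofAdd (p, q, r))) := by
  intro hc
  have h' := latticeHom_injective (mul_right_cancel (hc.symm.eq.trans (b_mul_latticeHom p q r)))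
  have h'' := Multiplicative.ofAdd.injective h'
  simp only [Prod.mk.injEq] at h''
  lia

end GSTK

/-!
STATEMENT 6: For integers `i, j, k` with `i ≠ 0` or `k ≠ 0`, the centralizer of
`aⁱ b^(2j) fᵏ` in `G_STK` is the subgroup generated by `{a, b², f}`, which is isomorphic
to `ℤ³` (the free abelian group of rank 3).
-/

theorem gstk_centralizer_eq_closure (i j k : ℤ) (h : i ≠ 0 ∨ k ≠ 0) :
    Subgroup.centralizer {GSTK.a ^ i * GSTK.b ^ (2 * j) * GSTK.f ^ k} =
        Subgroup.closure {GSTK.a, GSTK.b ^ 2, GSTK.f} ∧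
      Nonempty ((Subgroup.closure {GSTK.a, GSTK.b ^ 2, GSTK.f} : Subgroup GSTK) ≃*
        Multiplicative (ℤ × ℤ × ℤ)) := by
  have hz : GSTK.a ^ i * GSTK.b ^ (2 * j) * GSTK.f ^ k =
      GSTK.latticeHom (.ofAdd (i, j, k)) := by
    rw [GSTK.latticeHom_ofAdd, zpow_mul]
    rfl
  rw [hz, ← GSTK.range_latticeHom]
  refine ⟨?_, ⟨(MonoidHom.ofInjective GSTK.latticeHom_injective).symm⟩⟩
  ext g
  rw [Subgroup.mem_centralizer_singleton_iff]
  constructor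
  · intro hg
    obtain ⟨v, rfl | rfl⟩ := GSTK.exists_latticeHom g
    · exact ⟨v, rfl⟩
    · have hv := ((Commute.all v (.ofAdd (i, j, k))).map GSTK.latticeHom).inv_left.mul_left hg
      rw [inv_mul_cancel_left] at hv
      exact absurd hv (GSTK.not_commute_b_latticeHom h)
  · rintro ⟨v, rfl⟩
    exact (Commute.all v _).map GSTK.latticeHom
end

section
/- Let G_STK = ⟨a, b, f ∣ b a b⁻¹ = a⁻¹, b f b⁻¹ = f⁻¹, a f = f a⟩ and let ε : G_STK → ℤ/2ℤ be the unique group homomorphism with ε(a) = 0, ε(b) = 1, ε(f) = 0. Let H = {(n, g) ∈ ℤ × G_STK : the image of n in ℤ/2ℤ equals ε(g)}. Then H is the subgroup of ℤ × G_STK generated by the four elements (2, 1), (0, a), (1, b), (0, f), and H is isomorphic to ℤ × G_STK. -/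
/-- Given a homomorphism `ε : G_STK → ℤ/2ℤ`, the subgroup of `ℤ × G_STK` of pairs `(n, g)`
with `n ≡ ε g (mod 2)`. -/
def parityGraphSubgroup (ε : GSTK →* Multiplicative (ZMod 2)) :
    Subgroup (Multiplicative ℤ × GSTK) where
  carrier := {p | ((Multiplicative.toAdd p.1 : ℤ) : ZMod 2) = Multiplicative.toAdd (ε p.2)}
  one_mem' := by simp
  mul_mem' := by
    intro p q hp hq
    simp only [Set.mem_setOf_eq, Prod.fst_mul, Prod.snd_mul, toAdd_mul, Int.cast_add,
      map_mul] at *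
    rw [hp, hq]
  inv_mem' := by
    intro p hp
    simp only [Set.mem_setOf_eq, Prod.fst_inv, Prod.snd_inv, toAdd_inv, Int.cast_neg,
      map_inv] at *
    rw [hp]

namespace GSTK

/-- The exponent sum in `b`, as a homomorphism `G_STK → ℤ`. -/
def bDegree : GSTK →* Multiplicative ℤ :=
  PresentedGroup.toGroup (f := ![1, Multiplicative.ofAdd 1, 1]) (by
    rintro r (rfl | rfl | rfl) <;> simp)

@[simp] lemma bDegree_a : bDegree a = 1 := PresentedGroup.toGroup.of _

@[simp] lemma bDegree_b : bDegree b = Multiplicative.ofAdd 1 := PresentedGroup.toGroup.of _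

@[simp] lemma bDegree_f : bDegree f = 1 := PresentedGroup.toGroup.of _

/-- Homomorphisms out of `G_STK` agreeing on `a`, `b`, `f` are equal. -/
lemma hom_ext {M : Type*} [Group M] {φ ψ : GSTK →* M} (ha : φ a = ψ a) (hb : φ b = ψ b)
    (hf : φ f = ψ f) : φ = ψ := by
  refine PresentedGroup.ext fun i => ?_
  fin_cases i
  exacts [ha, hb, hf]

/-- A subgroup of `G_STK` containing `a`, `b`, `f` contains every element. -/
lemma mem_of_gens_mem {K : Subgroup GSTK} (ha : a ∈ K) (hb : b ∈ K) (hf : f ∈ K) (g : GSTK) :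
    g ∈ K := by
  have hK : Subgroup.closure (Set.range (PresentedGroup.of (rels := stkRels))) ≤ K := by
    rw [Subgroup.closure_le]
    rintro _ ⟨i, rfl⟩
    fin_cases i
    exacts [ha, hb, hf]
  exact hK (by simp)

/-- The embedding `(n, g) ↦ (2 n + bDegree g, g)` of `ℤ × G_STK` into itself. -/
def doubleShear : Multiplicative ℤ × GSTK →* Multiplicative ℤ × GSTK :=
  ((powMonoidHom 2).coprod bDegree).prod (MonoidHom.snd _ _)

lemma doubleShear_apply (p : Multiplicative ℤ × GSTK) :
    doubleShear p = (p.1 ^ 2 * bDegree p.2, p.2) := rfl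

lemma doubleShear_injective : Function.Injective doubleShear := by
  rintro ⟨m, g⟩ ⟨n, h⟩ hmn
  simp only [doubleShear_apply, Prod.mk.injEq] at hmn
  obtain ⟨hm, rfl⟩ := hmn
  have hsq : m ^ 2 = n ^ 2 := mul_right_cancel hm
  have hadd := congrArg Multiplicative.toAdd hsq
  simp only [toAdd_pow, nsmul_eq_mul, Nat.cast_ofNat] at hadd
  have hmn : m = n := Multiplicative.toAdd.injective (by omega)
  rw [hmn]

/-- A homomorphism `G_STK → ℤ/2ℤ` with the prescribed values on the generators is the
reduction of `bDegree`. -/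
lemma toAdd_eq_bDegree_cast {ε : GSTK →* Multiplicative (ZMod 2)}
    (ha : ε a = Multiplicative.ofAdd (0 : ZMod 2))
    (hb : ε b = Multiplicative.ofAdd (1 : ZMod 2))
    (hf : ε f = Multiplicative.ofAdd (0 : ZMod 2)) (g : GSTK) :
    Multiplicative.toAdd (ε g) = ((Multiplicative.toAdd (bDegree g) : ℤ) : ZMod 2) := by
  have h : ε = (AddMonoidHom.toMultiplicative (Int.castAddHom (ZMod 2))).comp bDegree :=
    hom_ext (by simp [ha]) (by simp [hb]) (by simp [hf])
  rw [h]
  rfl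

lemma range_doubleShear {ε : GSTK →* Multiplicative (ZMod 2)}
    (ha : ε a = Multiplicative.ofAdd (0 : ZMod 2))
    (hb : ε b = Multiplicative.ofAdd (1 : ZMod 2))
    (hf : ε f = Multiplicative.ofAdd (0 : ZMod 2)) :
    doubleShear.range = parityGraphSubgroup ε := by
  ext ⟨m, g⟩
  have hmem : (m, g) ∈ parityGraphSubgroup ε ↔
      ((Multiplicative.toAdd m : ℤ) : ZMod 2) = Multiplicative.toAdd (ε g) := Iff.rfl
  rw [hmem, toAdd_eq_bDegree_cast ha hb hf, eq_comm, ZMod.intCast_eq_intCast_iff_dvd_sub]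
  constructor
  · rintro ⟨⟨n, h⟩, hn⟩
    simp only [doubleShear_apply, Prod.mk.injEq] at hn
    obtain ⟨rfl, rfl⟩ := hn
    exact ⟨Multiplicative.toAdd n, by simp⟩
  · rintro ⟨k, hk⟩
    refine ⟨(Multiplicative.ofAdd k, g), Prod.ext (Multiplicative.toAdd.injective ?_) rfl⟩
    simp only [doubleShear_apply, toAdd_mul, toAdd_pow, toAdd_ofAdd, nsmul_eq_mul]
    push_cast at hk ⊢
    omega

lemma range_doubleShear_eq_closure :
    doubleShear.range = Subgroup.closure
        {(Multiplicative.ofAdd (2 : ℤ), (1 : GSTK)), (Multiplicative.ofAdd (0 : ℤ), a),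
         (Multiplicative.ofAdd (1 : ℤ), b), (Multiplicative.ofAdd (0 : ℤ), f)} := by
  apply le_antisymm
  · set C := Subgroup.closure
        {(Multiplicative.ofAdd (2 : ℤ), (1 : GSTK)), (Multiplicative.ofAdd (0 : ℤ), a),
         (Multiplicative.ofAdd (1 : ℤ), b), (Multiplicative.ofAdd (0 : ℤ), f)}
    have hgraph (g : GSTK) : g ∈ C.comap (bDegree.prod (MonoidHom.id GSTK)) := by
      refine mem_of_gens_mem ?_ ?_ ?_ g <;>
        exact Subgroup.subset_closure (by simp)
    have htwo : (Multiplicative.ofAdd (2 : ℤ), (1 : GSTK)) ∈ C :=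
      Subgroup.subset_closure (by simp)
    rintro _ ⟨⟨n, g⟩, rfl⟩
    have hsplit : doubleShear (n, g) =
        (Multiplicative.ofAdd (2 : ℤ), (1 : GSTK)) ^ Multiplicative.toAdd n *
          bDegree.prod (MonoidHom.id GSTK) g := by
      refine Prod.ext (Multiplicative.toAdd.injective ?_) ?_ <;>
        simp [doubleShear_apply, mul_comm]
    rw [hsplit]
    exact C.mul_mem (C.zpow_mem htwo _) (hgraph g)
  · rw [Subgroup.closure_le]
    rintro _ (rfl | rfl | rfl | rfl)
    · exact ⟨(Multiplicative.ofAdd 1, 1), by simp [doubleShear_apply, ← ofAdd_nsmul]⟩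
    · exact ⟨(1, a), by simp [doubleShear_apply]⟩
    · exact ⟨(1, b), by simp [doubleShear_apply]⟩
    · exact ⟨(1, f), by simp [doubleShear_apply]⟩

end GSTK

theorem parityGraphSubgroup_gens_and_iso (ε : GSTK →* Multiplicative (ZMod 2))
    (ha : ε GSTK.a = Multiplicative.ofAdd (0 : ZMod 2))
    (hb : ε GSTK.b = Multiplicative.ofAdd (1 : ZMod 2))
    (hf : ε GSTK.f = Multiplicative.ofAdd (0 : ZMod 2)) :
    parityGraphSubgroup ε = Subgroup.closure
        {(Multiplicative.ofAdd (2 : ℤ), (1 : GSTK)), (Multiplicative.ofAdd (0 : ℤ), GSTK.a),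
         (Multiplicative.ofAdd (1 : ℤ), GSTK.b), (Multiplicative.ofAdd (0 : ℤ), GSTK.f)} ∧
      Nonempty (parityGraphSubgroup ε ≃* Multiplicative ℤ × GSTK) := by
  have hrange := GSTK.range_doubleShear ha hb hf
  refine ⟨hrange.symm.trans GSTK.range_doubleShear_eq_closure, ⟨?_⟩⟩
  exact ((MonoidHom.ofInjective GSTK.doubleShear_injective).trans
    (MulEquiv.subgroupCongr hrange)).symm
end

section
/- Let F be a free group (on an arbitrary set of generators) and let H be a nontrivial subgroup of F in which any two elements commute. Then there exists a unique subgroup G' of F such that: G' is infinite cyclic (isomorphic to ℤ), H ≤ G', and G' is maximal among infinite cyclic subgroups of F, i.e. every infinite cyclic subgroup of F containing G' equals G'. -/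
/-!
STATEMENT 14: For a nontrivial subgroup `H` of a free group in which any two elements
commute, there is a unique subgroup `G'` such that `G'` is infinite cyclic, `H ≤ G'`, and
`G'` is maximal among infinite cyclic subgroups: every infinite cyclic subgroup containing
`G'` equals `G'`.
-/

/-- A subgroup is infinite cyclic if it is isomorphic to `ℤ`. -/
def Subgroup.IsInfiniteCyclic {G : Type*} [Group G] (K : Subgroup G) : Prop :=
  Nonempty (K ≃* Multiplicative ℤ)

/-- Distinct generators of a free group do not commute. -/
theorem FreeGroup.eq_of_commute_of {X : Type*} {a b : X}
    (h : Commute (FreeGroup.of a) (FreeGroup.of b)) : a = b := by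
  classical
  by_contra hab
  have key := h.map (FreeGroup.lift
    (fun x => if x = a then Equiv.swap (0 : Fin 3) 1 else Equiv.swap 1 2))
  simp only [FreeGroup.lift_apply_of, if_true, if_neg (Ne.symm hab)] at key
  exact absurd key.eq (by decide)

/-- A commutative free group is cyclic. -/
theorem IsFreeGroup.isCyclic_of_commute {G : Type*} [Group G] [IsFreeGroup G]
    (h : ∀ x y : G, Commute x y) : IsCyclic G := by
  have hs : Subsingleton (IsFreeGroup.Generators G) := ⟨fun a b =>
    FreeGroup.eq_of_commute_of (by
      simpa using (h (IsFreeGroup.mulEquiv G (.of a)) (IsFreeGroup.mulEquiv G (.of b))).map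
        (IsFreeGroup.mulEquiv G).symm)⟩
  have : IsCyclic (FreeGroup (IsFreeGroup.Generators G)) := by
    cases isEmpty_or_nonempty (IsFreeGroup.Generators G)
    · infer_instance
    · obtain ⟨_⟩ := nonempty_unique (IsFreeGroup.Generators G)
      infer_instance
  exact isCyclic_of_surjective (IsFreeGroup.mulEquiv G) (IsFreeGroup.mulEquiv G).surjective

/-- Commuting elements of a free group are powers of a common element. -/
theorem FreeGroup.exists_zpow_eq_of_commute {X : Type*} {x y : FreeGroup X} (h : Commute x y) :
    ∃ (c : FreeGroup X) (m n : ℤ), c ^ m = x ∧ c ^ n = y := by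
  let K := Subgroup.closure {x, y}
  have hK : IsMulCommutative K := Subgroup.isMulCommutative_closure (by
    rintro a (rfl | rfl) b (rfl | rfl)
    exacts [rfl, h.eq, h.eq.symm, rfl])
  obtain ⟨c, hc⟩ := IsFreeGroup.isCyclic_of_commute (G := K) fun a b => mul_comm' a b
  obtain ⟨m, hm⟩ := hc ⟨x, Subgroup.subset_closure (by simp)⟩
  obtain ⟨n, hn⟩ := hc ⟨y, Subgroup.subset_closure (by simp)⟩
  exact ⟨c, m, n, congrArg Subtype.val hm, congrArg Subtype.val hn⟩

/-- Anything commuting with a generator of a free group is a power of that generator. -/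
theorem FreeGroup.exists_zpow_of_eq_of_commute {X : Type*} {a : X} {z : FreeGroup X}
    (h : Commute (FreeGroup.of a) z) : ∃ n : ℤ, FreeGroup.of a ^ n = z := by
  obtain ⟨c, m, n, hm, rfl⟩ := FreeGroup.exists_zpow_eq_of_commute h
  have hdeg := congrArg (fun g => (FreeGroup.lift
    (fun _ : X => Multiplicative.ofAdd (1 : ℤ)) g).toAdd) hm
  simp only [map_zpow, toAdd_zpow, FreeGroup.lift_apply_of, toAdd_ofAdd, smul_eq_mul] at hdeg
  rcases Int.eq_one_or_neg_one_of_mul_eq_one hdeg with rfl | rfl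
  · exact ⟨n, by rw [← hm, zpow_one]⟩
  · exact ⟨-n, by rw [← hm]; simp⟩

/-- A free group with nontrivial center has at most one generator. -/
theorem FreeGroup.subsingleton_of_central {X : Type*} {z : FreeGroup X} (hz : z ≠ 1)
    (h : ∀ x, Commute x z) : Subsingleton X := by
  classical
  refine ⟨fun a b => by_contra fun hab => hz ?_⟩
  obtain ⟨n, hn⟩ := FreeGroup.exists_zpow_of_eq_of_commute (h (FreeGroup.of a))
  obtain ⟨k, hk⟩ := FreeGroup.exists_zpow_of_eq_of_commute (h (FreeGroup.of b))
  have hdeg := congrArg (fun g => (FreeGroup.lift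
    (fun x : X => Multiplicative.ofAdd (if x = a then (1 : ℤ) else 0)) g).toAdd) (hn.trans hk.symm)
  have hn0 : n = 0 := by simpa [Ne.symm hab] using hdeg
  rw [← hn, hn0, zpow_zero]

/-- The centralizer of a nontrivial element of a free group is infinite cyclic. -/
theorem FreeGroup.isInfiniteCyclic_centralizer {S : Type*} {z : FreeGroup S} (hz : z ≠ 1) :
    (Subgroup.centralizer {z}).IsInfiniteCyclic := by
  let C := Subgroup.centralizer {z}
  let e := IsFreeGroup.mulEquiv C
  let w : C := ⟨z, Subgroup.mem_centralizer_singleton_iff.2 rfl⟩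
  have hw : e.symm w ≠ 1 := by
    simpa [w, Subtype.ext_iff] using hz
  have hs : Subsingleton (IsFreeGroup.Generators C) :=
    FreeGroup.subsingleton_of_central hw fun x => by
      have hx : Commute (e x) w :=
        Subtype.ext (Subgroup.mem_centralizer_singleton_iff.1 (e x).2)
      simpa using hx.map e.symm
  have hne : Nonempty (IsFreeGroup.Generators C) := by
    by_contra hempty
    rw [not_nonempty_iff] at hempty
    exact hw (Subsingleton.elim _ _)
  obtain ⟨_⟩ := nonempty_unique (IsFreeGroup.Generators C)
  exact ⟨e.symm.trans FreeGroup.mulEquivIntOfUnique⟩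

theorem Subgroup.IsInfiniteCyclic.le_centralizer {G : Type*} [Group G] {K : Subgroup G}
    (hK : K.IsInfiniteCyclic) {z : G} (hz : z ∈ K) : K ≤ Subgroup.centralizer {z} := by
  obtain ⟨e⟩ := hK
  intro x hx
  have h : (⟨x, hx⟩ : K) * ⟨z, hz⟩ = ⟨z, hz⟩ * ⟨x, hx⟩ :=
    e.injective (by rw [map_mul, map_mul, mul_comm])
  exact Subgroup.mem_centralizer_singleton_iff.2 (congrArg Subtype.val h)

theorem freeGroup_abelian_subgroup_unique_maximal_infinite_cyclic
    {S : Type*} (H : Subgroup (FreeGroup S)) (hne : H ≠ ⊥)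
    (hcomm : ∀ x ∈ H, ∀ y ∈ H, x * y = y * x) :
    ∃! G' : Subgroup (FreeGroup S), G'.IsInfiniteCyclic ∧ H ≤ G' ∧
      ∀ G'' : Subgroup (FreeGroup S), G''.IsInfiniteCyclic → G' ≤ G'' → G'' = G' := by
  obtain ⟨z, hzH, hz⟩ := H.bot_or_exists_ne_one.resolve_left hne
  have hC := FreeGroup.isInfiniteCyclic_centralizer hz
  have hHC : H ≤ Subgroup.centralizer {z} := fun x hx =>
    Subgroup.mem_centralizer_singleton_iff.2 (hcomm x hx z hzH)
  refine ⟨Subgroup.centralizer {z}, ⟨hC, hHC, fun K hK hle => ?_⟩, ?_⟩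
  · exact le_antisymm (hK.le_centralizer (hle (hHC hzH))) hle
  · rintro K ⟨hK, hHK, hmax⟩
    exact (hmax _ hC (hK.le_centralizer (hHK hzH))).symm
end

section
/- Let T be the additive group endomorphism of the group of finitely supported functions ℤ → ℤ determined on standard basis vectors by T(e_j) = 2·e_j − e_{j+1} − e_{j−1} for all j ∈ ℤ. Then T is injective. -/
/-!
STATEMENT 16: The additive endomorphism `T` of the free abelian group `ℤ →₀ ℤ` determined
on standard basis vectors by `T eⱼ = 2 eⱼ - e_{j+1} - e_{j-1}` is injective.
-/

/-- Coordinates of the endomorphism `eⱼ ↦ 2 eⱼ - e_{j+1} - e_{j-1}`. -/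
theorem two_sub_shifts_apply
    (T : (ℤ →₀ ℤ) →+ (ℤ →₀ ℤ))
    (hT : ∀ j : ℤ, T (Finsupp.single j 1) =
      2 • Finsupp.single j (1 : ℤ) - Finsupp.single (j + 1) 1 - Finsupp.single (j - 1) 1)
    (f : ℤ →₀ ℤ) (k : ℤ) : T f k = 2 * f k - f (k - 1) - f (k + 1) := by
  induction f using Finsupp.induction_linear with
  | zero => simp
  | add f g hf hg =>
    simp only [map_add, Finsupp.add_apply, hf, hg]
    ring
  | single j c =>
    have hc : Finsupp.single j c = c • Finsupp.single j (1 : ℤ) := by simp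
    have h₁ : j + 1 = k ↔ j = k - 1 := by lia
    have h₂ : j - 1 = k ↔ j = k + 1 := by lia
    rw [hc, map_zsmul, hT]
    simp only [Finsupp.smul_apply, Finsupp.sub_apply, Finsupp.single_apply, h₁, h₂, smul_eq_mul,
      nsmul_eq_mul, Nat.cast_ofNat]
    ring

theorem two_sub_shifts_injective
    (T : (ℤ →₀ ℤ) →+ (ℤ →₀ ℤ))
    (hT : ∀ j : ℤ, T (Finsupp.single j 1) =
      2 • Finsupp.single j (1 : ℤ) - Finsupp.single (j + 1) 1 - Finsupp.single (j - 1) 1) :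
    Function.Injective T := by
  rw [injective_iff_map_eq_zero]
  intro f hf
  by_contra hne
  have hs : f.support.Nonempty := Finsupp.support_nonempty_iff.mpr hne
  set m := f.support.max' hs
  have hm : f m ≠ 0 := Finsupp.mem_support_iff.mp (f.support.max'_mem hs)
  have hgt (k : ℤ) (hk : m < k) : f k = 0 := by
    by_contra h
    exact hk.not_ge (f.support.le_max' k (Finsupp.mem_support_iff.mpr h))
  have h := two_sub_shifts_apply T hT f (m + 1)
  rw [hf, hgt (m + 1) (by lia), hgt (m + 1 + 1) (by lia), add_sub_cancel_right] at h
  simp at h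
  exact hm h
end
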